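/- There exists a task T = (Q, Q₀, A, rewards, δ) such that every reachable state of T has a path to goals(T) and Q₀ is reducible to goals(T), yet T is not learnable under fairness (i.e., some fair run on T does not converge). Hence the necessary conditions of the Proposition are not sufficient for learnability under fairness. -/

import Mathlib

/-!
Formalization of the navigational reinforcement learning framework of
Ameloot & Van den Bussche, "On the convergence of cycle detection for
navigational reinforcement learning".
-/

/-- A task `T = (Q, Q₀, A, rewards, δ)`: `Q` and `A` are (finite, nonempty) types,
`start` is a nonempty set of start states, `rewards` a nonempty set of
state-action pairs and `delta` maps each state-action pair to a nonempty
set of successor states. -/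
structure NavTask (Q A : Type) where
  start : Set Q
  start_nonempty : start.Nonempty
  rewards : Set (Q × A)
  rewards_nonempty : rewards.Nonempty
  delta : Q → A → Set Q
  delta_nonempty : ∀ q a, (delta q a).Nonempty

namespace NavTask

variable {Q A : Type}

/-- The goal states of a task. -/
def goals (T : NavTask Q A) : Set Q := {q | ∃ a, (q, a) ∈ T.rewards}

/-- The reducibility layers relative to a set `S`; `layers S 0` is the layer `F₁ = S`
of the paper, and `layers S n` is the layer `F_{n+1}`. -/
def layers (T : NavTask Q A) (S : Set Q) : ℕ → Set Q
  | 0 => S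
  | n + 1 => T.layers S n ∪ {q | ∃ a, T.delta q a ⊆ T.layers S n}

/-- `S'` is reducible to `S`. -/
def ReducibleTo (T : NavTask Q A) (S' S : Set Q) : Prop := S' ⊆ ⋃ n, T.layers S n

/-- `reduce T`: the set of states reducible to the goal states. -/
def reduce (T : NavTask Q A) : Set Q := ⋃ n, T.layers T.goals n

/-- A task is reducible if all states are reducible to the goal states. -/
def Reducible (T : NavTask Q A) : Prop := T.ReducibleTo Set.univ T.goals

end NavTask

/-- A configuration `(q, π, V)`: current state, policy, working memory. -/
structure Config (Q A : Type) where
  state : Q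
  pol : Q → A
  mem : Set Q

namespace Config

variable {Q A : Type}

/-- A configuration is branching if its current state has already been visited. -/
def Branching (c : Config Q A) : Prop := c.state ∈ c.mem

/-- Applying an option `(a, q')` to a configuration: move to `q'`, record action `a`
for the departed state, and mark the departed state as visited. -/
noncomputable def apply (c : Config Q A) (a : A) (q' : Q) : Config Q A :=
  letI := Classical.decEq Q
  ⟨q', Function.update c.pol c.state a, c.mem ∪ {c.state}⟩

end Config

/-- A transition: a four-tuple (source configuration, action, chosen successor
state, target configuration). -/
structure Step (Q A : Type) where
  src : Config Q A
  act : A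
  nxt : Q
  tgt : Config Q A

namespace NavTask

variable {Q A : Type}

/-- The options of a configuration: all actions if branching, otherwise only
the action given by the policy, paired with possible successor states. -/
def opts (T : NavTask Q A) (c : Config Q A) : Set (A × Q) :=
  {p | (c.Branching ∨ p.1 = c.pol c.state) ∧ p.2 ∈ T.delta c.state p.1}

/-- Validity of a transition. -/
def ValidStep (T : NavTask Q A) (t : Step Q A) : Prop :=
  (t.act, t.nxt) ∈ T.opts t.src ∧ t.tgt = t.src.apply t.act t.nxt

/-- A reward transition. -/
def IsRewardStep (T : NavTask Q A) (t : Step Q A) : Prop :=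
  (t.src.state, t.act) ∈ T.rewards

end NavTask

/-- A finite list of transitions is a chain: each target is the next source. -/
def IsChainList {Q A : Type} (l : List (Step Q A)) : Prop :=
  ∀ i (h : i + 1 < l.length),
    (l[i]'(Nat.lt_of_succ_lt h)).tgt = (l[i + 1]'h).src

/-- The first (source) configuration of a finite chain, if any. -/
def firstSrc? {Q A : Type} (l : List (Step Q A)) : Option (Config Q A) :=
  l.head?.map Step.src

/-- The last (target, i.e. terminal) configuration of a finite chain, if any. -/
def lastTgt? {Q A : Type} (l : List (Step Q A)) : Option (Config Q A) :=
  l.getLast?.map Step.tgt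

namespace NavTask

variable {Q A : Type}

/-- A finite trial: a nonempty valid chain ending with a reward transition and
containing no other reward transitions. -/
def IsFinTrial (T : NavTask Q A) (l : List (Step Q A)) : Prop :=
  l ≠ [] ∧ IsChainList l ∧ (∀ t ∈ l, T.ValidStep t) ∧
  (∀ t ∈ l.getLast?, T.IsRewardStep t) ∧
  (∀ i (h : i + 1 < l.length), ¬ T.IsRewardStep (l[i]'(Nat.lt_of_succ_lt h)))

/-- An infinite trial: an infinite valid chain with no reward transitions. -/
def IsInfTrial (T : NavTask Q A) (g : ℕ → Step Q A) : Prop :=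
  (∀ n, T.ValidStep (g n)) ∧ (∀ n, (g n).tgt = (g (n + 1)).src) ∧
  (∀ n, ¬ T.IsRewardStep (g n))

/-- A start configuration: a start state with empty working memory. -/
def IsStartConfig (T : NavTask Q A) (c : Config Q A) : Prop :=
  c.state ∈ T.start ∧ c.mem = ∅

/-- When a trial ends with `c₁`, the next trial starts with a configuration `c₂`
whose state is a start state, with the same policy, and empty working memory. -/
def Succession (T : NavTask Q A) (c₁ c₂ : Config Q A) : Prop :=
  c₂.state ∈ T.start ∧ c₂.pol = c₁.pol ∧ c₂.mem = ∅

end NavTask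

/-- A trial is either a finite or an infinite chain of transitions. -/
inductive Trial (Q A : Type) where
  | fin : List (Step Q A) → Trial Q A
  | inf : (ℕ → Step Q A) → Trial Q A

namespace Trial

variable {Q A : Type}

/-- A trial is finite (terminates). -/
def IsFinite : Trial Q A → Prop
  | .fin _ => True
  | .inf _ => False

/-- The configuration occurring at (0-based) position `n` of a trial: sources of
the transitions, plus (for a finite trial) the terminal configuration. -/
def config? : Trial Q A → ℕ → Option (Config Q A)
  | .fin l, n =>
      if h : n < l.length then some (l[n]'h).src
      else if n = l.length then lastTgt? l else none
  | .inf g, n => some (g n).src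

/-- Position `n` of a trial is non-terminal. -/
def NonTerminal : Trial Q A → ℕ → Prop
  | .fin l, n => n < l.length
  | .inf _, _ => True

/-- The positions at which state `q` occurs in a trial. -/
def stateOccs (tr : Trial Q A) (q : Q) : Set ℕ :=
  {n | ∃ c ∈ tr.config? n, c.state = q}

end Trial

/-- Validity of a trial. -/
def NavTask.IsTrial {Q A : Type} (T : NavTask Q A) : Trial Q A → Prop
  | .fin l => T.IsFinTrial l
  | .inf g => T.IsInfTrial g

/-- A run: either an infinite sequence of finite trials, or finitely many finite
trials followed by one infinite trial. -/
inductive Run (Q A : Type) where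
  | allFin : (ℕ → List (Step Q A)) → Run Q A
  | withInf : List (List (Step Q A)) → (ℕ → Step Q A) → Run Q A

/-- Validity of a run on a task. -/
def NavTask.IsRun {Q A : Type} (T : NavTask Q A) : Run Q A → Prop
  | .allFin f =>
      (∀ n, T.IsFinTrial (f n)) ∧
      (∀ c ∈ firstSrc? (f 0), T.IsStartConfig c) ∧
      (∀ n, ∀ c₁ ∈ lastTgt? (f n), ∀ c₂ ∈ firstSrc? (f (n + 1)), T.Succession c₁ c₂) ∧
      (∀ q ∈ T.start, {n | ∃ c ∈ firstSrc? (f n), c.state = q}.Infinite)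
  | .withInf L g =>
      (∀ l ∈ L, T.IsFinTrial l) ∧ T.IsInfTrial g ∧
      (L = [] → T.IsStartConfig (g 0).src) ∧
      (∀ l ∈ L.head?, ∀ c ∈ firstSrc? l, T.IsStartConfig c) ∧
      (∀ i (h : i + 1 < L.length),
        ∀ c₁ ∈ lastTgt? (L[i]'(Nat.lt_of_succ_lt h)),
        ∀ c₂ ∈ firstSrc? (L[i + 1]'h), T.Succession c₁ c₂) ∧
      (∀ c₁ ∈ lastTgt? (L.getLast?.getD []), T.Succession c₁ (g 0).src)

namespace Run

variable {Q A : Type}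

/-- The trials of a run. -/
def trials : Run Q A → Set (Trial Q A)
  | .allFin f => {tr | ∃ n, tr = .fin (f n)}
  | .withInf L g => {tr | (∃ l ∈ L, tr = .fin l) ∨ tr = .inf g}

/-- `P` holds at infinitely many transitions (equivalently, non-terminal
configuration occurrences) of the run, restricted to trials of index `≥ i`. -/
def InfOftenFrom : Run Q A → ℕ → (Step Q A → Prop) → Prop
  | .allFin f, i, P =>
      {p : ℕ × ℕ | i ≤ p.1 ∧ ∃ h : p.2 < (f p.1).length, P ((f p.1)[p.2]'h)}.Infinite
  | .withInf L g, i, P => i ≤ L.length ∧ {n | P (g n)}.Infinite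

/-- `P` holds at infinitely many transitions of the run. -/
def InfOften (R : Run Q A) (P : Step Q A → Prop) : Prop := R.InfOftenFrom 0 P

/-- A state is stable: only finitely many non-terminal occurrences of branching
configurations containing it. -/
def Stable (R : Run Q A) (q : Q) : Prop :=
  ¬ R.InfOften (fun t => t.src.state = q ∧ t.src.Branching)

/-- All trials of the run are finite. -/
def AllFinite : Run Q A → Prop
  | .allFin _ => True
  | .withInf _ _ => False

/-- A run converges: all trials terminate (with reward) and every state
eventually becomes stable. -/
def Converges (R : Run Q A) : Prop := R.AllFinite ∧ ∀ q, R.Stable q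

/-- Only finitely many trials contain more than `k` non-terminal configurations;
equivalently, from some trial index on, every trial has at most `k`
non-terminal configurations (sources of transitions). -/
def EventuallyBounded : Run Q A → ℕ → Prop
  | .allFin f, k => {n | k < (f n).length}.Finite
  | .withInf _ _, _ => False

/-- After trial `i` there are no more branching configurations at
non-terminal positions. -/
def NoBranchingAfter : Run Q A → ℕ → Prop
  | .allFin f, i => ∀ m, i < m → ∀ t ∈ f m, ¬ t.src.Branching
  | .withInf L g, i =>
      (∀ m, i < m → ∀ l ∈ L[m]?, ∀ t ∈ l, ¬ t.src.Branching) ∧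
      (i < L.length → ∀ n, ¬ (g n).src.Branching)

/-- Trial `i` of the run terminates (is finite). -/
def TrialTerminates : Run Q A → ℕ → Prop
  | .allFin _, _ => True
  | .withInf L _, i => i < L.length

/-- `i` is the convergence-trial index: the smallest trial index such that trial `i`
terminates and after trial `i` there are no branching configurations at
non-terminal positions. -/
def IsConvIndex (R : Run Q A) (i : ℕ) : Prop :=
  R.TrialTerminates i ∧ R.NoBranchingAfter i ∧
  ∀ j < i, ¬ (R.TrialTerminates j ∧ R.NoBranchingAfter j)

/-- `π` is the policy at the end of trial `i` of the run. -/
def EndPolicyAt : Run Q A → ℕ → (Q → A) → Prop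
  | .allFin f, i, π => ∃ t ∈ (f i).getLast?, t.tgt.pol = π
  | .withInf L _, i, π => ∃ l ∈ L[i]?, ∃ t ∈ l.getLast?, t.tgt.pol = π

/-- `π` is the final policy of the run: the policy at the end of the
convergence-trial. -/
def IsFinalPolicy (R : Run Q A) (π : Q → A) : Prop :=
  ∃ i, R.IsConvIndex i ∧ R.EndPolicyAt i π

/-- `π` occurs in the run at the end of some trial. -/
def EndsPolicy (R : Run Q A) (π : Q → A) : Prop := ∃ i, R.EndPolicyAt i π

end Run

namespace NavTask

variable {Q A : Type}

/-- Fairness: every configuration occurring infinitely often at non-terminal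
positions has each of its options taken infinitely often. -/
def Fair (T : NavTask Q A) (R : Run Q A) : Prop :=
  ∀ c : Config Q A, R.InfOften (fun t => t.src = c) →
    ∀ p ∈ T.opts c,
      R.InfOften (fun t => t = ⟨c, p.1, p.2, c.apply p.1 p.2⟩)

/-- A task is learnable under fairness if every fair run on it converges. -/
def Learnable (T : NavTask Q A) : Prop :=
  ∀ R : Run Q A, T.IsRun R → T.Fair R → R.Converges

/-- `ground π`: goal states assigned a rewarding action by the policy. -/
def ground (T : NavTask Q A) (π : Q → A) : Set Q := {q | (q, π q) ∈ T.rewards}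

/-- The forward layers of a policy; `fwd π 0` is `F₁ = Q₀` of the paper. -/
def fwd (T : NavTask Q A) (π : Q → A) : ℕ → Set Q
  | 0 => T.start
  | n + 1 => T.fwd π n ∪ ⋃ q ∈ T.fwd π n \ T.ground π, T.delta q (π q)

/-- `forward π`: states reachable from the start states by following `π`. -/
def forward (T : NavTask Q A) (π : Q → A) : Set Q := ⋃ n, T.fwd π n

/-- The backward layers of a policy; `bwd π 0` is `B₁ = ground(π)` of the paper. -/
def bwd (T : NavTask Q A) (π : Q → A) : ℕ → Set Q
  | 0 => T.ground π
  | n + 1 => T.bwd π n ∪ {q | T.delta q (π q) ⊆ T.bwd π n}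

/-- `backward π`: states reduced by `π` to the goal states in `ground π`. -/
def backward (T : NavTask Q A) (π : Q → A) : Set Q := ⋃ n, T.bwd π n

/-- A (simple) path from `q` to `q'`: non-reward transitions, pairwise distinct
states. -/
def Path (T : NavTask Q A) (q q' : Q) : Prop :=
  ∃ (n : ℕ) (s : ℕ → Q) (a : ℕ → A),
    s 0 = q ∧ s n = q' ∧
    (∀ i < n, s (i + 1) ∈ T.delta (s i) (a i)) ∧
    (∀ i < n, (s i, a i) ∉ T.rewards) ∧
    (∀ i ≤ n, ∀ j ≤ n, i ≠ j → s i ≠ s j)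

/-- A state is reachable: there is a path from some start state to it. -/
def Reachable (T : NavTask Q A) (q : Q) : Prop := ∃ q₀ ∈ T.start, T.Path q₀ q

/-- A state has a path to a set `S`. -/
def HasPathTo (T : NavTask Q A) (q : Q) (S : Set Q) : Prop := ∃ q' ∈ S, T.Path q q'

end NavTask

/-- A step occurring in a periodic run occurs infinitely often. -/
theorem Run.infOften_of_periodic {Q A : Type} {f : ℕ → List (Step Q A)} {k : ℕ} (hk : 0 < k)
    (hf : Function.Periodic f k) {m : ℕ} {t : Step Q A} (ht : t ∈ f m)
    {P : Step Q A → Prop} (hP : P t) : (Run.allFin f).InfOften P := by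
  obtain ⟨j, hj, rfl⟩ := List.getElem_of_mem ht
  have hper : ∀ n, f (m + n * k) = f m := fun n => by simpa using hf.nat_mul n m
  refine Set.infinite_of_injective_forall_mem (f := fun n : ℕ => (m + n * k, j)) ?_ ?_
  · intro a b hab
    simpa [hk.ne'] using hab
  · intro n
    refine ⟨Nat.zero_le _, ?_⟩
    simp only [hper]
    exact ⟨hj, hP⟩

/-- A property holding infinitely often holds at some step of some trial. -/
theorem Run.InfOften.exists_mem {Q A : Type} {f : ℕ → List (Step Q A)} {P : Step Q A → Prop}
    (h : (Run.allFin f).InfOften P) : ∃ n, ∃ t ∈ f n, P t := by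
  obtain ⟨⟨n, j⟩, -, hj, hP⟩ := Set.Infinite.nonempty h
  exact ⟨n, _, List.getElem_mem hj, hP⟩

namespace SwampTask

/-- The states of the counterexample: from `home` one can walk to the `goal` directly, or enter
the `swamp`, where every action may or may not lead to the goal. -/
inductive Place : Type
  | home
  | swamp
  | goal

open Place

instance : Fintype Place where
  elems := ⟨[home, swamp, goal], by simp⟩
  complete := by rintro (_ | _ | _) <;> simp

/-- The successor states in the counterexample. -/
def next : Place → Bool → Set Place
  | home, true => {goal}
  | home, false => {swamp}
  | swamp, _ => {swamp, goal}
  | goal, _ => {goal}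

/-- A task in which the bad choice at `home` is never reconsidered. -/
def task : NavTask Place Bool where
  start := {home}
  start_nonempty := Set.singleton_nonempty _
  rewards := {p | p.1 = goal}
  rewards_nonempty := ⟨(goal, true), rfl⟩
  delta := next
  delta_nonempty := by
    rintro (_ | _ | _) (_ | _) <;> simp [next]

/-- The policy that enters the swamp and there performs action `x`. -/
def policy (x : Bool) : Place → Bool
  | swamp => x
  | _ => false

/-- The configuration at the start of a trial. -/
def atHome (x : Bool) : Config Place Bool := ⟨home, policy x, ∅⟩

/-- The configuration upon entering the swamp. -/
def inSwamp (x : Bool) : Config Place Bool := ⟨swamp, policy x, {home}⟩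

/-- The branching configuration in the swamp. -/
def stuck (x : Bool) : Config Place Bool := ⟨swamp, policy x, {home, swamp}⟩

/-- The configuration upon reaching the goal. -/
def atGoal (x : Bool) : Config Place Bool := ⟨goal, policy x, {home, swamp}⟩

/-- The terminal configuration of a trial. -/
def done (x : Bool) : Config Place Bool := ⟨goal, policy x, Set.univ⟩

/-- The transitions occurring in the nonconverging run. -/
inductive Move : Type
  | enter (x : Bool)
  | cross (x : Bool)
  | sink (x : Bool)
  | stay (x y : Bool)
  | escape (x y : Bool)
  | finish (x : Bool)

namespace Move

/-- The transition described by a move. -/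
def step : Move → Step Place Bool
  | enter x => ⟨atHome x, false, swamp, inSwamp x⟩
  | cross x => ⟨inSwamp x, x, goal, atGoal x⟩
  | sink x => ⟨inSwamp x, x, swamp, stuck x⟩
  | stay x y => ⟨stuck x, y, swamp, stuck y⟩
  | escape x y => ⟨stuck x, y, goal, atGoal y⟩
  | finish x => ⟨atGoal x, false, goal, done x⟩

theorem tgt_step (m : Move) : m.step.tgt = m.step.src.apply m.step.act m.step.nxt := by
  cases m <;>
    simp only [step, Config.apply, atHome, inSwamp, stuck, atGoal, done, Config.mk.injEq,
      true_and] <;>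
    refine ⟨?_, ?_⟩ <;> ext q <;> cases q <;> simp [policy, Function.update]

theorem validStep_step (m : Move) : task.ValidStep m.step := by
  refine ⟨?_, m.tgt_step⟩
  cases m <;>
    simp [step, NavTask.opts, Config.Branching, atHome, inSwamp, stuck, atGoal, policy, task, next]

/-- Every option of a configuration occurring in a move is again described by a move. -/
theorem exists_step_eq (m : Move) {p : Bool × Place} (hp : p ∈ task.opts m.step.src) :
    ∃ m' : Move, m'.step = ⟨m.step.src, p.1, p.2, m.step.src.apply p.1 p.2⟩ := by
  suffices ∃ m' : Move, m'.step.src = m.step.src ∧ m'.step.act = p.1 ∧ m'.step.nxt = p.2 by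
    obtain ⟨m', h₁, h₂, h₃⟩ := this
    refine ⟨m', ?_⟩
    rw [← h₁, ← h₂, ← h₃, ← tgt_step]
  obtain ⟨a, q⟩ := p
  cases m with
  | enter x =>
    have h : a = false ∧ q ∈ next home a := by
      simpa [step, NavTask.opts, Config.Branching, atHome, policy, task] using hp
    obtain ⟨rfl, h⟩ := h
    exact ⟨enter x, rfl, rfl, Eq.symm h⟩
  | cross x | sink x =>
    have h : a = x ∧ (q = swamp ∨ q = goal) := by
      simpa [step, NavTask.opts, Config.Branching, inSwamp, policy, task, next] using hp
    obtain ⟨rfl, rfl | rfl⟩ := h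
    exacts [⟨sink a, rfl, rfl, rfl⟩, ⟨cross a, rfl, rfl, rfl⟩]
  | stay x y | escape x y =>
    have h : q = swamp ∨ q = goal := by
      simpa [step, NavTask.opts, Config.Branching, stuck, policy, task, next] using hp
    obtain rfl | rfl := h
    exacts [⟨stay x a, rfl, rfl, rfl⟩, ⟨escape x a, rfl, rfl, rfl⟩]
  | finish x =>
    have h : a = false ∧ q = goal := by
      simpa [step, NavTask.opts, Config.Branching, atGoal, policy, task, next] using hp
    obtain ⟨rfl, rfl⟩ := h
    exact ⟨finish x, rfl, rfl, rfl⟩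

end Move

open Move

/-- Six trials that together perform every move. -/
def cycle : Fin 6 → List Move
  | 0 => [enter false, cross false, finish false]
  | 1 => [enter false, sink false, stay false false, stay false true, stay true true,
      stay true false, escape false false, finish false]
  | 2 => [enter false, sink false, escape false true, finish true]
  | 3 => [enter true, cross true, finish true]
  | 4 => [enter true, sink true, escape true true, finish true]
  | 5 => [enter true, sink true, escape true false, finish false]

theorem exists_mem_cycle (m : Move) : ∃ i, m ∈ cycle i := by
  rcases m with (_ | _) | (_ | _) | (_ | _) | ⟨_ | _, _ | _⟩ | ⟨_ | _, _ | _⟩ | (_ | _)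
  exacts [⟨0, by simp [cycle]⟩, ⟨3, by simp [cycle]⟩, ⟨0, by simp [cycle]⟩, ⟨3, by simp [cycle]⟩,
    ⟨1, by simp [cycle]⟩, ⟨4, by simp [cycle]⟩, ⟨1, by simp [cycle]⟩, ⟨1, by simp [cycle]⟩,
    ⟨1, by simp [cycle]⟩, ⟨1, by simp [cycle]⟩, ⟨1, by simp [cycle]⟩, ⟨2, by simp [cycle]⟩,
    ⟨5, by simp [cycle]⟩, ⟨4, by simp [cycle]⟩, ⟨0, by simp [cycle]⟩, ⟨3, by simp [cycle]⟩]

/-- The trial performing the moves of `cycle i`. -/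
def trial (i : Fin 6) : List (Step Place Bool) := (cycle i).map step

theorem isFinTrial_trial (i : Fin 6) : task.IsFinTrial (trial i) := by
  refine ⟨?_, ?_, ?_, ?_, ?_⟩
  · fin_cases i <;> simp [trial, cycle]
  · intro j h
    have hj := Nat.lt_sub_of_add_lt h
    fin_cases i <;> simp [trial, cycle] at hj <;> interval_cases j <;> rfl
  · intro t ht
    obtain ⟨m, -, rfl⟩ := List.mem_map.1 ht
    exact m.validStep_step
  · fin_cases i <;> simp [trial, cycle, step, atGoal, NavTask.IsRewardStep, task]
  · intro j h
    have hj := Nat.lt_sub_of_add_lt h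
    fin_cases i <;> simp [trial, cycle] at hj <;> interval_cases j <;>
      simp [trial, cycle, step, NavTask.IsRewardStep, task, atHome, inSwamp, stuck]

/-- The periodic sequence of trials. -/
def trials (n : ℕ) : List (Step Place Bool) := trial (Fin.ofNat 6 n)

theorem periodic_trials : Function.Periodic trials 6 := by
  intro n
  simp [trials, Fin.ofNat]

theorem exists_step_mem_trials (m : Move) : ∃ n, m.step ∈ trials n := by
  obtain ⟨i, hi⟩ := exists_mem_cycle m
  exact ⟨i, by simpa [trials, trial] using ⟨m, hi, rfl⟩⟩

theorem infOften_trials (m : Move) {P : Step Place Bool → Prop} (h : P m.step) :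
    (Run.allFin trials).InfOften P :=
  let ⟨_, hn⟩ := exists_step_mem_trials m
  Run.infOften_of_periodic (by norm_num) periodic_trials hn h

theorem isStartConfig_firstSrc (i : Fin 6) :
    ∃ c ∈ firstSrc? (trial i), task.IsStartConfig c := by
  fin_cases i <;> simp [firstSrc?, trial, cycle, step, NavTask.IsStartConfig, task, atHome]

theorem succession_trial (i : Fin 6) :
    ∀ c₁ ∈ lastTgt? (trial i), ∀ c₂ ∈ firstSrc? (trial (i + 1)), task.Succession c₁ c₂ := by
  fin_cases i <;>
    simp [firstSrc?, lastTgt?, trial, cycle, step, NavTask.Succession, task, atHome, done]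

theorem isRun_trials : task.IsRun (.allFin trials) := by
  refine ⟨fun n => isFinTrial_trial _, ?_, ?_, ?_⟩
  · intro c hc
    obtain ⟨c', hc', h⟩ := isStartConfig_firstSrc (Fin.ofNat 6 0)
    rwa [Option.mem_unique hc hc']
  · intro n
    have h : Fin.ofNat 6 (n + 1) = Fin.ofNat 6 n + 1 := by
      ext
      simp [Fin.ofNat, Fin.val_add]
    simpa only [trials, h] using succession_trial (Fin.ofNat 6 n)
  · rintro q rfl
    convert Set.infinite_univ (α := ℕ)
    refine Set.eq_univ_of_forall fun n => ?_
    obtain ⟨c, hc, h⟩ := isStartConfig_firstSrc (Fin.ofNat 6 n)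
    exact ⟨c, hc, h.1⟩

theorem fair_trials : task.Fair (.allFin trials) := by
  rintro c hc p hp
  obtain ⟨n, t, ht, rfl⟩ := hc.exists_mem
  obtain ⟨m, -, rfl⟩ := List.mem_map.1 ht
  obtain ⟨m', hm'⟩ := m.exists_step_eq hp
  exact infOften_trials m' hm'

theorem not_converges_trials : ¬ (Run.allFin trials).Converges := fun h =>
  h.2 swamp (infOften_trials (stay true true)
    ⟨rfl, by simp [step, stuck, Config.Branching]⟩)

theorem hasPathTo_goals (q : Place) : task.HasPathTo q task.goals := by
  refine ⟨goal, ⟨true, rfl⟩, ?_⟩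
  by_cases hq : q = goal
  · exact ⟨0, fun _ => q, fun _ => true, by simp [hq]⟩
  · refine ⟨1, fun i => if i = 0 then q else goal, fun _ => true, rfl, rfl, ?_, ?_, ?_⟩
    · cases q <;> simp [task, next] at hq ⊢
    · simpa [task] using hq
    · intro i hi j hj hij
      interval_cases i <;> interval_cases j <;> simp_all [eq_comm]

theorem reducibleTo_goals : task.ReducibleTo task.start task.goals := by
  rintro q rfl
  refine Set.mem_iUnion.2 ⟨1, Or.inr ⟨true, ?_⟩⟩
  rintro q rfl
  exact ⟨true, rfl⟩

end SwampTask

/-- There is a task whose reachable states all have a path to the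
goal states and whose start states are reducible to the goal states, yet which
is not learnable under fairness: some fair run on it does not converge. -/
theorem necessary_conditions_not_sufficient :
    ∃ (Q A : Type) (_ : Fintype Q) (_ : Fintype A) (T : NavTask Q A),
      (∀ q : Q, T.Reachable q → T.HasPathTo q T.goals) ∧
      T.ReducibleTo T.start T.goals ∧
      ∃ R : Run Q A, T.IsRun R ∧ T.Fair R ∧ ¬ R.Converges := by
  exact ⟨SwampTask.Place, Bool, inferInstance, inferInstance, SwampTask.task,
    fun q _ => SwampTask.hasPathTo_goals q, SwampTask.reducibleTo_goals, .allFin SwampTask.trials,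
    SwampTask.isRun_trials, SwampTask.fair_trials, SwampTask.not_converges_trials⟩
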